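/- Let U be an open subset of ℂⁿ, let k ≤ n, and let (A_i)_{i∈ℕ} be a sequence of nonempty closed subsets of U such that: (i) ℋ^{2k}(A_i ∩ A_j) = 0 whenever i ≠ j; (ii) for every i, every a ∈ A_i, and every r > 0 with B_r(a) ⊆ U, one has ℋ^{2k}(A_i ∩ B_r(a)) ≥ Ω(2k)·r^{2k}. Set A = ⋃_{i=1}^∞ A_i and suppose A is ℋ^{2k}-locally finite, i.e. for every u ∈ U there is r > 0 with ℋ^{2k}(A ∩ B_r(u)) < ∞. Then every point of U has an open neighborhood that meets only finitely many of the sets A_i; consequently A is closed in U. -/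

import Mathlib

open MeasureTheory Metric

noncomputable instance (n : ℕ) : MeasurableSpace (EuclideanSpace ℂ (Fin n)) := borel _

instance (n : ℕ) : BorelSpace (EuclideanSpace ℂ (Fin n)) := ⟨rfl⟩

/-- A countable, `ℋ^{2k}`-locally finite union `A = ⋃ᵢ Aᵢ` of nonempty closed subsets of an
open set `U ⊆ ℂⁿ`, each satisfying the volume lower bound
`ℋ^{2k}(Aᵢ ∩ B_r(a)) ≥ Ω(2k) r^{2k}` at each of its points and with `ℋ^{2k}`-null pairwise
intersections, is locally a finite union: every point of `U` has an open neighborhood meeting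
only finitely many `Aᵢ`; consequently `A` is closed in `U`. -/
theorem locally_finite_union_subvarieties (n k : ℕ) (hkn : k ≤ n)
    (U : Set (EuclideanSpace ℂ (Fin n))) (hU : IsOpen U)
    (A : ℕ → Set (EuclideanSpace ℂ (Fin n))) (hAU : ∀ i, A i ⊆ U)
    (hne : ∀ i, (A i).Nonempty)
    (hclosed : ∀ i, IsClosed (Subtype.val ⁻¹' (A i) : Set U))
    (hdisj : ∀ i j, i ≠ j → μH[(2 * k : ℝ)] (A i ∩ A j) = 0)
    (hvol : ∀ i, ∀ a ∈ A i, ∀ r : ℝ, 0 < r → ball a r ⊆ U →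
      volume (ball (0 : EuclideanSpace ℝ (Fin (2 * k))) 1) * ENNReal.ofReal (r ^ (2 * k)) ≤
        μH[(2 * k : ℝ)] (A i ∩ ball a r))
    (hlocfin : ∀ u ∈ U, ∃ r : ℝ, 0 < r ∧ μH[(2 * k : ℝ)] ((⋃ i, A i) ∩ ball u r) < ⊤) :
    (∀ u ∈ U, ∃ V : Set (EuclideanSpace ℂ (Fin n)),
        IsOpen V ∧ u ∈ V ∧ {i : ℕ | (A i ∩ V).Nonempty}.Finite) ∧
      IsClosed (Subtype.val ⁻¹' (⋃ i, A i) : Set U) := by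
  have hmeas : ∀ i, MeasurableSet (A i) := by
    intro i
    have h := (hU.measurableSet).subtype_image (hclosed i).measurableSet
    rwa [Subtype.image_preimage_coe, Set.inter_eq_right.mpr (hAU i)] at h
  have key : ∀ u ∈ U, ∃ V : Set (EuclideanSpace ℂ (Fin n)),
      IsOpen V ∧ u ∈ V ∧ {i : ℕ | (A i ∩ V).Nonempty}.Finite := by
    intro u hu
    obtain ⟨r, hr, hfin⟩ := hlocfin u hu
    obtain ⟨t, ht, htU⟩ := Metric.isOpen_iff.mp hU u hu
    obtain ⟨s, hs, hsr, hst⟩ : ∃ s : ℝ, 0 < s ∧ s + s ≤ r ∧ s + s ≤ t :=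
      ⟨min r t / 2, by positivity, by linarith [min_le_left r t], by linarith [min_le_right r t]⟩
    refine ⟨ball u s, isOpen_ball, mem_ball_self hs, ?_⟩
    have hc : 0 < volume (ball (0 : EuclideanSpace ℝ (Fin (2 * k))) 1) *
        ENNReal.ofReal (s ^ (2 * k)) := by
      refine ENNReal.mul_pos (measure_ball_pos _ _ one_pos).ne' ?_
      exact (ENNReal.ofReal_pos.mpr (pow_pos hs _)).ne'
    have hF := Measure.finite_const_le_meas_of_disjoint_iUnion₀ (μH[(2 * k : ℝ)]) hc
      (As := fun i => A i ∩ ball u r)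
      (fun i => ((hmeas i).inter isOpen_ball.measurableSet).nullMeasurableSet)
      (fun i j hij => measure_mono_null
        (Set.inter_subset_inter Set.inter_subset_left Set.inter_subset_left) (hdisj i j hij))
      (by rw [← Set.iUnion_inter]; exact hfin.ne)
    refine hF.subset ?_
    rintro i ⟨a, haA, hau⟩
    have hd : dist a u < s := hau
    refine (hvol i a haA s hs ?_).trans (measure_mono ?_)
    · exact (ball_subset_ball' (by linarith)).trans htU
    · exact Set.inter_subset_inter_right _ (ball_subset_ball' (by linarith))
  refine ⟨key, ?_⟩
  rw [Set.preimage_iUnion]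
  refine LocallyFinite.isClosed_iUnion ?_ hclosed
  intro x
  obtain ⟨V, hV, hxV, hf⟩ := key x x.2
  refine ⟨Subtype.val ⁻¹' V, (hV.preimage continuous_subtype_val).mem_nhds hxV, hf.subset ?_⟩
  rintro i ⟨y, hy1, hy2⟩
  exact ⟨y, hy1, hy2⟩
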